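/- arXiv:1811.10140 — 2 statements merged into one kernel-verified Lean document; each statement's English description precedes it below -/
import Mathlib

section
/- Let 𝒜 and ℬ be contexts on H. Then 𝒜ℬ = ℬ𝒜 (equality of product channels, as sets of nonzero products of branches) if and only if 𝒜 = ℬ (as sets of projections). -/
variable {H : Type*} [NormedAddCommGroup H] [InnerProductSpace ℂ H] [CompleteSpace H]

/-- The rank-one projection `|φ⟩⟨φ|`. -/
noncomputable def rankOne (φ : H) : H →L[ℂ] H := (innerSL ℂ φ).smulRight φ

/-- A sharp channel: a family of pairwise orthogonal nonzero orthogonal projections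
summing to `I` in the strong operator topology. -/
def IsSharpChannel (S : Set (H →L[ℂ] H)) : Prop :=
  (∀ P ∈ S, IsSelfAdjoint P ∧ IsIdempotentElem P ∧ P ≠ 0) ∧
  (∀ P ∈ S, ∀ Q ∈ S, P ≠ Q → P * Q = 0) ∧
  (∀ x : H, HasSum (fun P : S => (P : H →L[ℂ] H) x) x)

/-- A context: a sharp channel all of whose branches are rank-one projections. -/
def IsContext (S : Set (H →L[ℂ] H)) : Prop :=
  IsSharpChannel S ∧ ∀ P ∈ S, ∃ φ : H, ‖φ‖ = 1 ∧ P = rankOne φ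

/-- The product channel 𝒜ℬ = {PQ : P ∈ 𝒜, Q ∈ ℬ}, discarding zero products. -/
def prodChannel (A B : Set (H →L[ℂ] H)) : Set (H →L[ℂ] H) :=
  {R | R ≠ 0 ∧ ∃ P ∈ A, ∃ Q ∈ B, R = P * Q}

theorem rankOne_smul_of_norm_eq_one {c : ℂ} (hc : ‖c‖ = 1) (φ : H) :
    rankOne (c • φ) = rankOne φ := by
  ext x
  have h : c * (starRingEnd ℂ) c = 1 := by
    rw [Complex.mul_conj, Complex.normSq_eq_norm_sq, hc]
    norm_num
  simp only [rankOne, ContinuousLinearMap.smulRight_apply, innerSL_apply_apply, inner_smul_left,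
    smul_smul]
  congr 1
  linear_combination (inner ℂ φ x) * h

/-- Rank-one projections onto unit vectors agree as soon as their ranges share a nonzero vector. -/
theorem rankOne_eq_of_apply_eq {φ ψ : H} (hφ : ‖φ‖ = 1) (hψ : ‖ψ‖ = 1) {y z : H}
    (h : rankOne φ y = rankOne ψ z) (h0 : rankOne φ y ≠ 0) : rankOne φ = rankOne ψ := by
  simp only [rankOne, ContinuousLinearMap.smulRight_apply, innerSL_apply_apply] at h h0
  have ha : inner ℂ φ y ≠ 0 := fun h' => h0 (by rw [h', zero_smul])
  have hφψ : φ = ((inner ℂ φ y)⁻¹ * inner ℂ ψ z) • ψ := by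
    rw [mul_smul, ← h, inv_smul_smul₀ ha]
  have hc := congrArg norm hφψ
  rw [norm_smul, hφ, hψ, mul_one] at hc
  rw [hφψ]
  exact rankOne_smul_of_norm_eq_one hc.symm ψ

theorem IsSharpChannel.exists_mul_ne_zero {S : Set (H →L[ℂ] H)} (hS : IsSharpChannel S)
    {P : H →L[ℂ] H} (hP : P ≠ 0) : ∃ Q ∈ S, P * Q ≠ 0 := by
  by_contra! h
  refine hP (ContinuousLinearMap.ext fun x => ?_)
  have hs : HasSum (fun Q : S => P ((Q : H →L[ℂ] H) x)) (P x) := P.hasSum (hS.2.2 x)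
  have hz : (fun Q : S => P ((Q : H →L[ℂ] H) x)) = fun _ => 0 :=
    funext fun Q => congrArg (fun T : H →L[ℂ] H => T x) (h Q Q.2)
  rw [hz] at hs
  exact hs.unique hasSum_zero

theorem IsContext.subset_of_prodChannel_subset {A B : Set (H →L[ℂ] H)} (hA : IsContext A)
    (hB : IsContext B) (h : prodChannel A B ⊆ prodChannel B A) : A ⊆ B := by
  intro P hP
  obtain ⟨Q, hQ, hPQ⟩ := hB.1.exists_mul_ne_zero (hA.1.1 P hP).2.2
  obtain ⟨-, Q', hQ', P', -, heq⟩ := h ⟨hPQ, P, hP, Q, hQ, rfl⟩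
  obtain ⟨x, hx⟩ := DFunLike.ne_iff.mp hPQ
  obtain ⟨φ, hφ, rfl⟩ := hA.2 P hP
  obtain ⟨ψ, hψ, rfl⟩ := hB.2 Q' hQ'
  have hx' : rankOne φ (Q x) = rankOne ψ (P' x) := congrArg (fun T : H →L[ℂ] H => T x) heq
  rwa [rankOne_eq_of_apply_eq hφ hψ hx' hx]

theorem stmt_6 [TopologicalSpace.SeparableSpace H] (A B : Set (H →L[ℂ] H))
    (hA : IsContext A) (hB : IsContext B) :
    prodChannel A B = prodChannel B A ↔ A = B := by
  refine ⟨fun h => ?_, fun h => by rw [h]⟩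
  exact (hA.subset_of_prodChannel_subset hB h.subset).antisymm
    (hB.subset_of_prodChannel_subset hA h.symm.subset)
end

section
/- Let 𝒜 and ℬ be contexts on H. If L_𝒜(P) = L_ℬ(P) for every branch P ∈ 𝒜, then 𝒜 = ℬ (as sets of projections). -/
variable {H : Type*} [NormedAddCommGroup H] [InnerProductSpace ℂ H] [CompleteSpace H]

theorem rankOne_apply (φ x : H) : rankOne φ x = inner ℂ φ x • φ := rfl

/-- Two commuting rank-one projections with nonzero product coincide. -/
theorem rankOne_eq_of_commute {φ ψ : H} (hφ : ‖φ‖ = 1) (hψ : ‖ψ‖ = 1)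
    (hcomm : Commute (rankOne φ) (rankOne ψ)) (hne : rankOne φ * rankOne ψ ≠ 0) :
    rankOne φ = rankOne ψ := by
  have hc : inner ℂ φ ψ ≠ 0 := by
    intro h0
    refine hne (ContinuousLinearMap.ext fun x => ?_)
    simp [rankOne_apply, h0]
  have hcφ : inner ℂ φ ψ • φ = inner ℂ φ ψ • (inner ℂ ψ φ • ψ) := by
    have := congrArg (fun T : H →L[ℂ] H => T ψ) hcomm.eq
    simpa [rankOne_apply, inner_smul_right, inner_self_eq_norm_sq_to_K, hψ, smul_smul] using this
  obtain ⟨c, rfl⟩ : ∃ c : ℂ, φ = c • ψ := ⟨_, smul_right_injective H hc hcφ⟩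
  have hc1 : ‖c‖ = 1 := by simpa [norm_smul, hψ] using hφ
  have hcc : c * (starRingEnd ℂ) c = 1 := by simp [Complex.mul_conj', hc1]
  ext x
  rw [rankOne_apply, rankOne_apply, inner_smul_left, smul_smul, mul_right_comm,
    mul_comm _ c, hcc, one_mul]

namespace IsSharpChannel

variable {S : Set (H →L[ℂ] H)}

theorem apply_apply_self (hS : IsSharpChannel S) {P : H →L[ℂ] H} (hP : P ∈ S) (x : H) :
    P (P x) = P x :=
  congrArg (fun T : H →L[ℂ] H => T x) (hS.1 P hP).2.1.eq

theorem apply_apply_of_ne (hS : IsSharpChannel S) {P Q : H →L[ℂ] H} (hP : P ∈ S) (hQ : Q ∈ S)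
    (hne : P ≠ Q) (x : H) : P (Q x) = 0 :=
  congrArg (fun T : H →L[ℂ] H => T x) (hS.2.1 P hP Q hQ hne)

theorem exists_apply_ne_zero (hS : IsSharpChannel S) {x : H} (hx : x ≠ 0) :
    ∃ P ∈ S, P x ≠ 0 := by
  by_contra! hzero
  have hsum := hS.2.2 x
  simp only [hzero _ (Subtype.coe_prop _)] at hsum
  exact hx (hsum.unique hasSum_zero)

/-- The channel map fixes every branch. -/
theorem channel_apply_of_mem (hS : IsSharpChannel S) {P Z : H →L[ℂ] H} (hP : P ∈ S)
    (hZ : ∀ x, HasSum (fun R : S => (R : H →L[ℂ] H) (P ((R : H →L[ℂ] H) x))) (Z x)) :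
    Z = P := by
  ext x
  have hsingle := hasSum_single (f := fun R : S => (R : H →L[ℂ] H) (P ((R : H →L[ℂ] H) x)))
    ⟨P, hP⟩ fun R hR => hS.apply_apply_of_ne R.2 hP (fun h => hR (Subtype.ext h)) _
  simpa [hS.apply_apply_self hP] using (hZ x).unique hsingle

/-- Every value of the channel map commutes with every branch. -/
theorem commute_channel (hS : IsSharpChannel S) {Q Y Z : H →L[ℂ] H} (hQ : Q ∈ S)
    (hZ : ∀ x, HasSum (fun R : S => (R : H →L[ℂ] H) (Y ((R : H →L[ℂ] H) x))) (Z x)) :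
    Commute Z Q := by
  ext x
  have hright := hasSum_single (f := fun R : S => (R : H →L[ℂ] H) (Y ((R : H →L[ℂ] H) (Q x))))
    ⟨Q, hQ⟩ fun R hR => by
      simp [hS.apply_apply_of_ne R.2 hQ (fun h => hR (Subtype.ext h))]
  have hleft := hasSum_single
    (f := fun R : S => Q ((R : H →L[ℂ] H) (Y ((R : H →L[ℂ] H) x))))
    ⟨Q, hQ⟩ fun R hR => hS.apply_apply_of_ne hQ R.2 (fun h => hR (Subtype.ext h.symm)) _
  have hZQ : Z (Q x) = Q (Y (Q x)) := by
    simpa [hS.apply_apply_self hQ] using (hZ (Q x)).unique hright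
  have hQZ : Q (Z x) = Q (Y (Q x)) := by
    simpa [hS.apply_apply_self hQ] using (Q.hasSum (hZ x)).unique hleft
  exact hZQ.trans hQZ.symm

/-- A sharp channel contained in another one is equal to it. -/
theorem eq_of_subset {T : Set (H →L[ℂ] H)} (hS : IsSharpChannel S) (hT : IsSharpChannel T)
    (hST : S ⊆ T) : S = T := by
  refine hST.antisymm fun Q hQ => ?_
  obtain ⟨x, hx⟩ : ∃ x, Q x ≠ 0 := by
    by_contra! hzero
    exact (hT.1 Q hQ).2.2 (ContinuousLinearMap.ext hzero)
  obtain ⟨P, hP, hPx⟩ := hS.exists_apply_ne_zero hx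
  by_cases hPQ : P = Q
  · exact hPQ ▸ hP
  · exact absurd (hT.apply_apply_of_ne (hST hP) hQ hPQ x) hPx

end IsSharpChannel

theorem stmt_8 [TopologicalSpace.SeparableSpace H] (A B : Set (H →L[ℂ] H))
    (hA : IsContext A) (hB : IsContext B)
    -- LA and LB are the channel maps of 𝒜 and ℬ:
    (LA LB : (H →L[ℂ] H) → (H →L[ℂ] H))
    (hLA : ∀ (Y : H →L[ℂ] H) (x : H),
      HasSum (fun P : A => (P : H →L[ℂ] H) (Y ((P : H →L[ℂ] H) x))) (LA Y x))
    (hLB : ∀ (Y : H →L[ℂ] H) (x : H),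
      HasSum (fun Q : B => (Q : H →L[ℂ] H) (Y ((Q : H →L[ℂ] H) x))) (LB Y x))
    -- if L_𝒜(P) = L_ℬ(P) for every branch P ∈ 𝒜 ...
    (h : ∀ P ∈ A, LA P = LB P) :
    -- ... then 𝒜 = ℬ:
    A = B := by
  refine hA.1.eq_of_subset hB.1 fun P hP => ?_
  have hLBP : LB P = P := (h P hP).symm.trans (hA.1.channel_apply_of_mem hP (hLA P))
  obtain ⟨φ, hφ, hPφ⟩ := hA.2 P hP
  have hφ0 : φ ≠ 0 := by
    rintro rfl
    simp at hφ
  obtain ⟨Q, hQ, hQφ⟩ := hB.1.exists_apply_ne_zero hφ0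
  obtain ⟨ψ, hψ, hQψ⟩ := hB.2 Q hQ
  have hcomm : Commute P Q := hLBP ▸ hB.1.commute_channel hQ (hLB P)
  have hPφφ : P φ = φ := by
    simp [hPφ, rankOne_apply, inner_self_eq_norm_sq_to_K, hφ]
  have hne : P * Q ≠ 0 := by
    intro h0
    have := congrArg (fun T : H →L[ℂ] H => T φ) (hcomm.eq.symm.trans h0)
    exact hQφ (by simpa [hPφφ] using this)
  have hPQ : P = Q := by
    subst hPφ hQψ
    exact rankOne_eq_of_commute hφ hψ hcomm hne
  exact hPQ ▸ hQ
end
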